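/- arXiv:0911.4419 — 2 statements merged into one kernel-verified Lean document; each statement's English description precedes it below -/
import Mathlib

section
/- Let H be a separable complex Hilbert space and T = ∑_k λ_k e_k a discrete statistic weakly sufficient for a family (φ_θ)_{θ∈Θ} of unit vectors, with e_k φ_θ = γ_k(θ) ξ_k (γ_k : Θ → ℂ, ξ_k unit vectors), and assume that for each k the function γ_k is not identically zero. Declare j ∼ m iff there exists β ≠ 0 with γ_j(θ) = β γ_m(θ) for all θ; this is an equivalence relation on ℕ. Let s : ℕ → ℝ be any function such that s(j) = s(m) if and only if j ∼ m. Then S_s = ∑_k s(k) e_k is a minimal weakly sufficient statistic with respect to T: S_s is weakly sufficient, and for every g : ℕ → ℝ such that S_g = ∑_k g(k) e_k is weakly sufficient, there exists Ψ : ℝ → ℝ with s(k) = Ψ(g(k)) for all k. -/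
open scoped InnerProductSpace

section OrthogonalProjections

variable {H : Type*} [NormedAddCommGroup H] [InnerProductSpace ℂ H] {e : ℕ → H →L[ℂ] H}

lemma apply_eq_of_hasSum_orthogonal (hidem : ∀ k, e k * e k = e k)
    (horth : ∀ j k, j ≠ k → e j * e k = 0) {b : ℕ → ℂ} {χ ψ : H}
    (h : HasSum (fun k => b k • e k χ) ψ) (k : ℕ) : e k ψ = b k • e k χ := by
  have h1 := h.mapL (e k)
  refine h1.unique ?_
  have h2 : e k (b k • e k χ) = b k • e k χ := by
    rw [map_smul, ← mul_apply_eq_comp, hidem]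
  rw [← h2]
  refine hasSum_single k fun j hj => ?_
  rw [map_smul, ← mul_apply_eq_comp, horth k j hj.symm]
  simp

/-- The coefficients of a generating vector `χ` along the `ξ k`. -/
lemma exists_coefficients_of_weaklySufficient (hidem : ∀ k, e k * e k = e k)
    (horth : ∀ j k, j ≠ k → e j * e k = 0) {Θ : Type*} {φ : Θ → H}
    {γ : ℕ → Θ → ℂ} {ξ : ℕ → H} (hξ : ∀ k, ‖ξ k‖ = 1)
    (hγ : ∀ k θ, e k (φ θ) = γ k θ • ξ k) (hγne : ∀ k, ∃ θ, γ k θ ≠ 0)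
    {χ : H} {c : Θ → ℂ} (hc : ∀ θ, ‖c θ‖ = 1) {a : Θ → ℕ → ℝ}
    (h : ∀ θ, HasSum (fun k => (a θ k : ℂ) • e k χ) (c θ • φ θ)) :
    ∃ μ : ℕ → ℂ, (∀ k, μ k ≠ 0) ∧ ∀ k θ, (a θ k : ℂ) * μ k = c θ * γ k θ := by
  have hc0 : ∀ θ, c θ ≠ 0 := fun θ h0 => by simpa [h0] using hc θ
  have hξ0 : ∀ k, ξ k ≠ 0 := fun k h0 => by simpa [h0] using hξ k
  have key : ∀ k θ, (a θ k : ℂ) • e k χ = (c θ * γ k θ) • ξ k := fun k θ => by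
    rw [← apply_eq_of_hasSum_orthogonal hidem horth (h θ) k, map_smul, hγ, smul_smul]
  choose θ₀ hθ₀ using hγne
  have ha : ∀ k, (a (θ₀ k) k : ℂ) ≠ 0 := fun k h0 => by
    have := key k (θ₀ k)
    rw [h0, zero_smul] at this
    exact smul_ne_zero (mul_ne_zero (hc0 _) (hθ₀ k)) (hξ0 k) this.symm
  refine ⟨fun k => (a (θ₀ k) k : ℂ)⁻¹ * (c (θ₀ k) * γ k (θ₀ k)),
    fun k => mul_ne_zero (inv_ne_zero (ha k)) (mul_ne_zero (hc0 _) (hθ₀ k)), fun k θ => ?_⟩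
  apply smul_left_injective ℂ (hξ0 k)
  have h1 : e k χ = ((a (θ₀ k) k : ℂ)⁻¹ * (c (θ₀ k) * γ k (θ₀ k))) • ξ k := by
    rw [mul_smul, ← key, smul_smul, inv_mul_cancel₀ (ha k), one_smul]
  change _ • ξ k = _ • ξ k
  rw [← key k θ, h1, smul_smul]

variable [CompleteSpace H]

lemma orthonormal_of_mem_range_projections (hsa : ∀ k, IsSelfAdjoint (e k))
    {ξ : ℕ → H} (hξ : ∀ k, ‖ξ k‖ = 1) (hself : ∀ k, e k (ξ k) = ξ k)
    (horth : ∀ j k, j ≠ k → e j * e k = 0) : Orthonormal ℂ ξ := by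
  refine ⟨hξ, fun j k hjk => ?_⟩
  have h1 := (hsa j).isSymmetric (ξ j) (ξ k)
  simp only [ContinuousLinearMap.coe_coe] at h1
  rw [hself, ← hself k, ← mul_apply_eq_comp, horth j k hjk] at h1
  rw [hself] at h1
  simpa using h1

lemma Orthonormal.summable_smul {ξ : ℕ → H} (hξ : Orthonormal ℂ ξ) {t : ℕ → ℂ}
    (ht : Summable fun k => ‖t k‖ ^ 2) : Summable fun k => t k • ξ k := by
  simpa using (hξ.orthogonalFamily.summable_iff_norm_sq_summable t).2 ht

end OrthogonalProjections

lemma summable_weight_mul_diagonal {w : ℕ → ℝ} {f : ℕ → ℕ → ℝ} {B : ℝ}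
    (hw : ∀ n, 0 ≤ w n) (hsw : Summable w) (hf : ∀ n k, 0 ≤ f n k)
    (hsf : ∀ n, Summable (f n)) (hB : ∀ n, ∑' k, f n k ≤ B) (r : ℕ → ℕ) :
    Summable fun k => w (r k) * f (r k) k := by
  have h : Summable fun p : ℕ × ℕ => w p.1 * f p.1 p.2 := by
    have h0 : (0 : ℕ × ℕ → ℝ) ≤ fun p => w p.1 * f p.1 p.2 :=
      fun p => mul_nonneg (hw p.1) (hf p.1 p.2)
    refine (summable_prod_of_nonneg h0).2 ⟨fun n => (hsf n).mul_left (w n), ?_⟩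
    simp only [tsum_mul_left]
    exact Summable.of_nonneg_of_le
      (fun n => mul_nonneg (hw n) (tsum_nonneg (hf n)))
      (fun n => mul_le_mul_of_nonneg_left (hB n) (hw n)) (hsw.mul_right B)
  have hi : Function.Injective fun k => (r k, k) := fun j k hjk => (Prod.ext_iff.1 hjk).2
  exact h.comp_injective hi

/-- Let T = ∑ₖ λₖ eₖ be a discrete statistic weakly sufficient for (φ_θ),
with eₖ φ_θ = γₖ(θ) ξₖ, all γₖ not identically zero.  The relation j ∼ m ⟺
∃ β ≠ 0, γⱼ = β γₘ is an equivalence relation, and for any s : ℕ → ℝ with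
s j = s m ⟺ j ∼ m, the statistic S_s = ∑ₖ s(k) eₖ is a minimal weakly sufficient
statistic with respect to T. -/
theorem minimal_weakly_sufficient_statistic
    {H : Type*} [NormedAddCommGroup H] [InnerProductSpace ℂ H]
    [CompleteSpace H] [TopologicalSpace.SeparableSpace H]
    {Θ : Type*} (φ : Θ → H) (hφ : ∀ θ, ‖φ θ‖ = 1)
    (e : ℕ → H →L[ℂ] H) (lam : ℕ → ℝ)
    (hsa : ∀ k, IsSelfAdjoint (e k))
    (hidem : ∀ k, e k * e k = e k)
    (horth : ∀ j k, j ≠ k → e j * e k = 0)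
    (hsum : ∀ ξ : H, HasSum (fun k => e k ξ) ξ)
    (hlam : Function.Injective lam)
    (hT : ∃ (χ : H) (c : Θ → ℂ) (a : Θ → ℕ → ℝ),
      (∀ θ, ‖c θ‖ = 1) ∧
      ∀ θ, HasSum (fun k => (a θ k : ℂ) • e k χ) (c θ • φ θ))
    (γ : ℕ → Θ → ℂ) (ξ : ℕ → H) (hξ : ∀ k, ‖ξ k‖ = 1)
    (hγ : ∀ k θ, e k (φ θ) = γ k θ • ξ k)
    (hγne : ∀ k, ∃ θ, γ k θ ≠ 0)
    (s : ℕ → ℝ)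
    (hs : ∀ j m, s j = s m ↔ ∃ β : ℂ, β ≠ 0 ∧ ∀ θ, γ j θ = β * γ m θ) :
    Equivalence (fun j m : ℕ => ∃ β : ℂ, β ≠ 0 ∧ ∀ θ, γ j θ = β * γ m θ) ∧
    (∃ (χ : H) (c : Θ → ℂ) (Ψ : Θ → ℝ → ℝ),
      (∀ θ, ‖c θ‖ = 1) ∧
      ∀ θ, HasSum (fun k => (Ψ θ (s k) : ℂ) • e k χ) (c θ • φ θ)) ∧
    (∀ g : ℕ → ℝ,
      (∃ (χ : H) (c : Θ → ℂ) (Ψ : Θ → ℝ → ℝ),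
        (∀ θ, ‖c θ‖ = 1) ∧
        ∀ θ, HasSum (fun k => (Ψ θ (g k) : ℂ) • e k χ) (c θ • φ θ)) →
      ∃ Ψ' : ℝ → ℝ, ∀ k, s k = Ψ' (g k)) := by
  refine ⟨⟨fun j => (hs j j).1 rfl, fun {j m} h => (hs m j).1 ((hs j m).2 h).symm,
    fun {i j k} h h' => (hs i k).1 (((hs i j).2 h).trans ((hs j k).2 h'))⟩, ?_, ?_⟩
  · obtain ⟨χ, c, a, hc, ha⟩ := hT
    have hc0 : ∀ θ, c θ ≠ 0 := fun θ h0 => by simpa [h0] using hc θ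
    obtain ⟨μ, hμ, hμa⟩ :=
      exists_coefficients_of_weaklySufficient hidem horth hξ hγ hγne hc ha
    choose θ₀ hθ₀ using hγne
    have hself : ∀ k, e k (ξ k) = ξ k := fun k => by
      apply smul_right_injective H (hθ₀ k)
      change γ k (θ₀ k) • e k (ξ k) = γ k (θ₀ k) • ξ k
      rw [← map_smul, ← hγ, ← mul_apply_eq_comp, hidem]
    have hon := orthonormal_of_mem_range_projections hsa hξ hself horth
    have hinner : ∀ k θ, ⟪ξ k, φ θ⟫_ℂ = γ k θ := fun k θ => by
      have h1 := (hsa k).isSymmetric (ξ k) (φ θ)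
      simp only [ContinuousLinearMap.coe_coe] at h1
      rw [hself, hγ, inner_smul_right, inner_self_eq_norm_sq_to_K, hξ] at h1
      simpa using h1
    obtain ⟨R, hR⟩ : ∃ R : ℝ → ℕ, ∀ k, s (R (s k)) = s k :=
      ⟨Function.invFun s, fun k => Function.invFun_eq ⟨k, rfl⟩⟩
    set t : ℕ → ℂ := fun k =>
      (1 / 2 : ℂ) ^ R (s k) * (c (θ₀ (R (s k))) * γ k (θ₀ (R (s k)))) with ht
    have hts : Summable fun k => ‖t k‖ ^ 2 := by
      have h := summable_weight_mul_diagonal (w := fun n => (1 / 4 : ℝ) ^ n)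
        (f := fun n k => ‖γ k (θ₀ n)‖ ^ 2) (B := 1) (fun n => by positivity)
        (summable_geometric_of_lt_one (by norm_num) (by norm_num))
        (fun n k => by positivity)
        (fun n => by simpa only [hinner] using hon.inner_products_summable (φ (θ₀ n)))
        (fun n => by
          simpa only [hinner, hφ, one_pow] using hon.tsum_inner_products_le (φ (θ₀ n)))
        (fun k => R (s k))
      refine h.congr fun k => ?_
      rw [ht]
      simp only [norm_mul, norm_pow, hc, one_mul, mul_pow, ← pow_mul]
      rw [mul_comm (R (s k)) 2, pow_mul]
      norm_num
    have hsumm := hon.summable_smul hts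
    have hproj : ∀ k, e k (∑' n, t n • ξ n) = t k • ξ k := fun k => by
      refine (hsumm.hasSum.mapL (e k)).unique ?_
      have h2 : e k (t k • ξ k) = t k • ξ k := by rw [map_smul, hself]
      rw [← h2]
      refine hasSum_single k fun j hj => ?_
      rw [map_smul, ← hself j, ← mul_apply_eq_comp, horth k j hj.symm]
      simp
    refine ⟨∑' n, t n • ξ n, c,
      fun θ x => 2 ^ R x * (a θ (R x) / a (θ₀ (R x)) (R x)), hc, fun θ => ?_⟩
    convert hsum (c θ • φ θ) using 2 with k
    rw [hproj, map_smul, hγ, smul_smul, smul_smul]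
    congr 1
    obtain ⟨β, -, hβ⟩ := (hs k (R (s k))).1 (hR k).symm
    simp only [ht, hβ]
    generalize R (s k) = r
    have h1 := hμa r θ
    have h2 := hμa r (θ₀ r)
    have h3 : (a (θ₀ r) r : ℂ) ≠ 0 := fun h0 => by
      rw [h0, zero_mul] at h2
      exact mul_ne_zero (hc0 _) (hθ₀ r) h2.symm
    have h4 : (2 : ℂ) ^ r * (1 / 2) ^ r = 1 := by rw [← mul_pow]; norm_num
    push_cast
    calc (2 : ℂ) ^ r * (a θ r / a (θ₀ r) r) *
          ((1 / 2) ^ r * (c (θ₀ r) * (β * γ r (θ₀ r))))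
        = ((2 : ℂ) ^ r * (1 / 2) ^ r) * (a θ r / a (θ₀ r) r) *
          (β * (c (θ₀ r) * γ r (θ₀ r))) := by ring
      _ = β * (a θ r * μ r) := by rw [h4, ← h2]; field_simp
      _ = c θ * (β * γ r θ) := by rw [h1]; ring
  · rintro g ⟨χ, c, Ψ, hc, hΨ⟩
    have hc0 : ∀ θ, c θ ≠ 0 := fun θ h0 => by simpa [h0] using hc θ
    obtain ⟨μ, hμ, hμΨ⟩ := exists_coefficients_of_weaklySufficient hidem horth hξ hγ hγne hc
      (a := fun θ k => Ψ θ (g k)) hΨ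
    have hfac : Function.FactorsThrough s g := fun j m hjm => by
      refine (hs j m).2 ⟨μ j / μ m, div_ne_zero (hμ j) (hμ m), fun θ => ?_⟩
      apply mul_left_cancel₀ (hc0 θ)
      have hm := hμ m
      rw [← hμΨ j θ, hjm, mul_left_comm, ← hμΨ m θ]
      field_simp
    exact ⟨Function.extend g s 0, fun k => (hfac.extend_apply 0 k).symm⟩
end

section
/- Let H be a separable complex Hilbert space, (e_k)_{k∈ℕ} pairwise orthogonal orthogonal projections summing strongly to the identity, (λ_k) distinct real numbers, and T = ∑_k λ_k e_k the corresponding discrete statistic. Let N be the von Neumann algebra generated by (e_k). Suppose α : B(H) → B(H) is a positive linear contraction with α(B(H)) = N (range contained in N and every element of N is attained), and suppose (φ_θ)_{θ∈Θ} is a family of unit vectors each of which is α-invariant (so T is sufficient in the sense of Petz for the family, via the map α onto N). Then T is weakly sufficient for (φ_θ)_{θ∈Θ}. -/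
open scoped InnerProductSpace

namespace PositiveLinearMap

open scoped ComplexOrder

theorem map_star_mul_eq_zero {A : Type*} [NonUnitalCStarAlgebra A] [PartialOrder A]
    [StarOrderedRing A] (f : A →ₚ[ℂ] ℂ) {a : A} (ha : f (star a * a) = 0) (b : A) :
    f (star a * b) = 0 := by
  have h := norm_inner_le_norm (𝕜 := ℂ) (f.toPreGNS a) (f.toPreGNS b)
  rw [f.preGNS_inner_def, f.preGNS_norm_def (f.toPreGNS a)] at h
  simpa [ha] using h

/-- A positive functional on `B(H)` vanishing on the projection complementary to the unit
vector `φ` is a multiple of the vector functional of `φ`. -/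
theorem apply_eq_inner_mul_of_map_one_sub_rankOne {H : Type*} [NormedAddCommGroup H]
    [InnerProductSpace ℂ H] [CompleteSpace H] (f : (H →L[ℂ] H) →ₚ[ℂ] ℂ) {φ : H} (hφ : ‖φ‖ = 1)
    (h : f (1 - InnerProductSpace.rankOne ℂ φ φ) = 0) (x : H →L[ℂ] H) :
    f x = ⟪φ, x φ⟫_ℂ * f (InnerProductSpace.rankOne ℂ φ φ) := by
  set p : H →L[ℂ] H := InnerProductSpace.rankOne ℂ φ φ with hp
  have hpp : p * p = p := InnerProductSpace.isIdempotentElem_rankOne_self hφ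
  have hps : star p = p := by
    rw [ContinuousLinearMap.star_eq_adjoint, hp, InnerProductSpace.adjoint_rankOne]
  have hqs : star (1 - p) = 1 - p := by simp [hps]
  have hq : f (star (1 - p) * (1 - p)) = 0 := by
    rw [hqs, (IsIdempotentElem.one_sub hpp).eq, h]
  have hl (y : H →L[ℂ] H) : f ((1 - p) * y) = 0 := by
    simpa only [hqs] using f.map_star_mul_eq_zero hq y
  have hr (y : H →L[ℂ] H) : f (y * (1 - p)) = 0 := by
    have := congrArg star (hl (star y))
    rwa [← map_star f, star_mul, star_star, hqs, star_zero] at this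
  have hx : p * x * p = ⟪φ, x φ⟫_ℂ • p := by
    ext ζ
    simp [hp, smul_smul, mul_comm]
  have hdec : x = (1 - p) * x + p * x * (1 - p) + p * x * p := by noncomm_ring
  calc f x = f ((1 - p) * x + p * x * (1 - p) + p * x * p) := congrArg f hdec
    _ = ⟪φ, x φ⟫_ℂ * f p := by
      rw [map_add, map_add, hl, hr, hx, map_smul, smul_eq_mul, zero_add, zero_add]

end PositiveLinearMap

section DiscreteStatistic

variable {H : Type*} [NormedAddCommGroup H] [InnerProductSpace ℂ H] {e : ℕ → H →L[ℂ] H}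

theorem comp_apply_of_hasSum_smul (hidem : ∀ k, e k * e k = e k)
    (horth : ∀ j k, j ≠ k → e j * e k = 0) {c : ℕ → ℂ} {y : H →L[ℂ] H}
    (hy : ∀ ζ : H, HasSum (fun k => c k • e k ζ) (y ζ)) (k : ℕ) (ζ : H) :
    y (e k ζ) = c k • e k ζ := by
  have h : HasSum (fun j => c j • e j (e k ζ)) (c k • e k (e k ζ)) := by
    refine hasSum_single k fun j hj => ?_
    rw [← mul_apply_eq_comp, horth j k hj]
    simp
  rw [(hy (e k ζ)).unique h, ← mul_apply_eq_comp, hidem]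

theorem exists_norm_one_smul_eq_of_inner_apply_eq {φ ψ : H} (hφ : ‖φ‖ = 1) (hψ : ‖ψ‖ = 1)
    (h : ∀ x : H →L[ℂ] H, ⟪φ, x φ⟫_ℂ = ⟪ψ, x ψ⟫_ℂ) : ∃ c : ℂ, ‖c‖ = 1 ∧ c • φ = ψ := by
  have h1 := congrArg norm (h (InnerProductSpace.rankOne ℂ φ φ))
  have h2 : ‖⟪φ, ψ⟫_ℂ‖ = ‖φ‖ * ‖ψ‖ := by
    simp only [InnerProductSpace.rankOne_apply, inner_smul_right, inner_self_eq_norm_sq_to_K, hφ,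
      norm_mul, norm_inner_symm ψ φ] at h1
    rw [hφ, hψ]
    have := norm_nonneg ⟪φ, ψ⟫_ℂ
    norm_num at h1
    nlinarith
  have hφ0 : φ ≠ 0 := by rintro rfl; simp at hφ
  have hψ0 : ψ ≠ 0 := by rintro rfl; simp at hψ
  obtain ⟨r, -, hr⟩ := (norm_inner_eq_norm_iff hφ0 hψ0).1 h2
  refine ⟨r, ?_, hr.symm⟩
  rw [hr, norm_smul, hφ, mul_one] at hψ
  exact hψ

variable [CompleteSpace H]

open scoped ComplexOrder in
/-- If a positive map has all its values acting as scalars on the range of the projection `p`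
and leaves the vector state of `φ` invariant, then the vector functional of `p φ` pulls back to
a multiple of the vector state of `φ`. -/
theorem exists_inner_apply_eq_mul_inner {p : H →L[ℂ] H} (hsa : IsSelfAdjoint p)
    (hidem : p * p = p) {α : (H →L[ℂ] H) →ₗ[ℂ] (H →L[ℂ] H)}
    (hpos : ∀ x : H →L[ℂ] H, x.IsPositive → (α x).IsPositive)
    (hscalar : ∀ x, ∃ c : ℂ, ∀ ζ, α x (p ζ) = c • p ζ) {φ : H} (hφ : ‖φ‖ = 1)
    (hinv : ∀ x : H →L[ℂ] H, ⟪φ, α x φ⟫_ℂ = ⟪φ, x φ⟫_ℂ) :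
    ∃ μ : ℂ, ∀ x : H →L[ℂ] H, ⟪p φ, α x (p φ)⟫_ℂ = ⟪φ, x φ⟫_ℂ * μ := by
  let g : (H →L[ℂ] H) →ₗ[ℂ] ℂ :=
    { toFun := fun x => ⟪p φ, α x (p φ)⟫_ℂ
      map_add' := by simp
      map_smul' := by simp }
  let f : (H →L[ℂ] H) →ₚ[ℂ] ℂ := PositiveLinearMap.mk₀ g fun x hx =>
    (hpos x ((ContinuousLinearMap.nonneg_iff_isPositive x).1 hx)).inner_nonneg_right _
  refine ⟨_, f.apply_eq_inner_mul_of_map_one_sub_rankOne hφ ?_⟩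
  set q : H →L[ℂ] H := 1 - InnerProductSpace.rankOne ℂ φ φ with hq
  have hqpos : q.IsPositive := by
    apply ContinuousLinearMap.IsPositive.of_isStarProjection
    refine IsStarProjection.one_sub ⟨InnerProductSpace.isIdempotentElem_rankOne_self hφ, ?_⟩
    rw [IsSelfAdjoint, ContinuousLinearMap.star_eq_adjoint, InnerProductSpace.adjoint_rankOne]
  have hA := hpos q hqpos
  have h0 : ⟪φ, α q φ⟫_ℂ = 0 := by
    rw [hinv]
    simp [hq, inner_self_eq_norm_sq_to_K, hφ]
  obtain ⟨c, hc⟩ := hscalar q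
  have horth : ⟪φ - p φ, p φ⟫_ℂ = 0 := by
    rw [← ContinuousLinearMap.adjoint_inner_left, hsa.adjoint_eq, map_sub,
      ← mul_apply_eq_comp, hidem]
    simp
  have h1 : ⟪φ - p φ, α q (p φ)⟫_ℂ = 0 := by rw [hc, inner_smul_right, horth, mul_zero]
  have h2 : ⟪p φ, α q (φ - p φ)⟫_ℂ = 0 := by
    rw [← hA.inner_left_eq_inner_right, ← inner_conj_symm, h1, map_zero]
  have hsplit : ⟪φ, α q φ⟫_ℂ
      = ⟪p φ, α q (p φ)⟫_ℂ + ⟪φ - p φ, α q (φ - p φ)⟫_ℂ := by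
    conv_lhs => rw [← add_sub_cancel (p φ) φ, map_add, inner_add_left, inner_add_right,
      inner_add_right, h1, h2]
    ring
  rw [h0] at hsplit
  exact ((add_eq_zero_iff_of_nonneg (hA.inner_nonneg_right _) (hA.inner_nonneg_right _)).1
    hsplit.symm).1

/-- A unit vector invariant under a positive map onto the algebra generated by the `e k` lies in
the range of a single `e k`. -/
theorem exists_apply_eq_self_of_invariant (hsa : ∀ k, IsSelfAdjoint (e k))
    (hidem : ∀ k, e k * e k = e k) (horth : ∀ j k, j ≠ k → e j * e k = 0)
    (hsum : ∀ ξ : H, HasSum (fun k => e k ξ) ξ)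
    {α : (H →L[ℂ] H) →ₗ[ℂ] (H →L[ℂ] H)}
    (hpos : ∀ x : H →L[ℂ] H, x.IsPositive → (α x).IsPositive)
    (hscalar : ∀ x k, ∃ c : ℂ, ∀ ζ, α x (e k ζ) = c • e k ζ)
    (honto : ∀ k, ∃ x, α x = e k) {φ : H} (hφ : ‖φ‖ = 1)
    (hinv : ∀ x : H →L[ℂ] H, ⟪φ, α x φ⟫_ℂ = ⟪φ, x φ⟫_ℂ) :
    ∃ k, e k φ = φ := by
  have hex : ∃ k, e k φ ≠ 0 := by
    by_contra! h0
    have h := hsum φ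
    simp only [h0] at h
    simp [h.unique hasSum_zero] at hφ
  obtain ⟨k, hk⟩ := hex
  refine ⟨k, (hasSum_single k fun j hjk => ?_).unique (hsum φ)⟩
  by_contra hj
  obtain ⟨μ, hμ⟩ := exists_inner_apply_eq_mul_inner (hsa k) (hidem k) hpos
    (fun x => hscalar x k) hφ hinv
  obtain ⟨ν, hν⟩ := exists_inner_apply_eq_mul_inner (hsa j) (hidem j) hpos
    (fun x => hscalar x j) hφ hinv
  obtain ⟨x, hx⟩ := honto k
  obtain ⟨y, hy⟩ := honto j
  have hxk := hμ x
  have hxj := hν x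
  have hyj := hν y
  rw [hx, ← mul_apply_eq_comp, hidem] at hxk
  rw [hx, ← mul_apply_eq_comp, horth k j hjk.symm] at hxj
  rw [hy, ← mul_apply_eq_comp, hidem] at hyj
  have hxφ : ⟪φ, x φ⟫_ℂ ≠ 0 := by
    intro h
    rw [h, zero_mul, inner_self_eq_zero] at hxk
    exact hk hxk
  have hν0 : ν = 0 := by simpa [hxφ] using hxj.symm
  rw [hν0, mul_zero, inner_self_eq_zero] at hyj
  exact hj hyj

/-- Bounded vectors in the ranges of the `e k` are the components of a single vector, up to
nonzero real factors. -/
theorem exists_apply_eq_smul (horth : ∀ j k, j ≠ k → e j * e k = 0) {v : ℕ → H}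
    (hv : ∀ k, e k (v k) = v k) (hbound : ∀ k, ‖v k‖ ≤ 1) :
    ∃ χ : H, ∀ k, ((2 : ℝ) ^ k : ℝ) • e k χ = v k := by
  have hs : Summable fun k => ((1 / 2 : ℝ) ^ k) • v k := by
    refine Summable.of_norm_bounded summable_geometric_two fun k => ?_
    rw [norm_smul, Real.norm_of_nonneg (by positivity)]
    exact mul_le_of_le_one_right (by positivity) (hbound k)
  refine ⟨∑' k, ((1 / 2 : ℝ) ^ k) • v k, fun k => ?_⟩
  rw [(e k).map_tsum hs, tsum_eq_single k fun j hj => ?_]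
  · rw [ContinuousLinearMap.map_smul_of_tower, hv, smul_smul, ← mul_pow]
    simp
  · rw [ContinuousLinearMap.map_smul_of_tower, ← hv j, ← mul_apply_eq_comp,
      horth k j hj.symm]
    simp

end DiscreteStatistic

/-- Let T = ∑ₖ λₖ eₖ be a discrete statistic and N the von Neumann algebra
generated by the eₖ.  If α is a positive linear contraction on B(H) with α(B(H)) = N
(range contained in N, and every element ∑ₖ cₖ eₖ of N attained), and every member of the
family (φ_θ) of unit vectors is α-invariant (sufficiency in the sense of Petz), then T is
weakly sufficient for (φ_θ). -/
theorem weakly_sufficient_of_petz_sufficient_onto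
    {H : Type*} [NormedAddCommGroup H] [InnerProductSpace ℂ H]
    [CompleteSpace H] [TopologicalSpace.SeparableSpace H]
    (e : ℕ → H →L[ℂ] H) (lam : ℕ → ℝ)
    (hsa : ∀ k, IsSelfAdjoint (e k))
    (hidem : ∀ k, e k * e k = e k)
    (horth : ∀ j k, j ≠ k → e j * e k = 0)
    (hsum : ∀ ξ : H, HasSum (fun k => e k ξ) ξ)
    (hlam : Function.Injective lam)
    (α : (H →L[ℂ] H) →ₗ[ℂ] (H →L[ℂ] H))
    (hpos : ∀ x : H →L[ℂ] H, x.IsPositive → (α x).IsPositive)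
    (hcontr : ∀ x : H →L[ℂ] H, ‖α x‖ ≤ ‖x‖)
    (hrange : ∀ x : H →L[ℂ] H, ∃ c : ℕ → ℂ, (∃ M : ℝ, ∀ k, ‖c k‖ ≤ M) ∧
      ∀ ζ : H, HasSum (fun k => c k • e k ζ) (α x ζ))
    (honto : ∀ c : ℕ → ℂ, (∃ M : ℝ, ∀ k, ‖c k‖ ≤ M) →
      ∃ x : H →L[ℂ] H, ∀ ζ : H, HasSum (fun k => c k • e k ζ) (α x ζ))
    {Θ : Type*} (φ : Θ → H) (hφ : ∀ θ, ‖φ θ‖ = 1)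
    (hinv : ∀ (θ : Θ) (x : H →L[ℂ] H), ⟪φ θ, α x (φ θ)⟫_ℂ = ⟪φ θ, x (φ θ)⟫_ℂ) :
    ∃ (χ : H) (c : Θ → ℂ) (a : Θ → ℕ → ℝ),
      (∀ θ, ‖c θ‖ = 1) ∧
      ∀ θ, HasSum (fun k => (a θ k : ℂ) • e k χ) (c θ • φ θ) := by
  have hscalar (x : H →L[ℂ] H) (k : ℕ) : ∃ c : ℂ, ∀ ζ, α x (e k ζ) = c • e k ζ := by
    obtain ⟨c, -, hc⟩ := hrange x
    exact ⟨c k, comp_apply_of_hasSum_smul hidem horth hc k⟩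
  have honto' (k : ℕ) : ∃ x, α x = e k := by
    obtain ⟨x, hx⟩ := honto (Pi.single k 1) ⟨1, fun j => by
      by_cases h : j = k
      · subst h; simp
      · simp [h]⟩
    refine ⟨x, ContinuousLinearMap.ext fun ζ => (hx ζ).unique ?_⟩
    convert hasSum_single k fun j hj => ?_ using 1
    · simp
    · simp [hj]
  choose κ hκ using fun θ => exists_apply_eq_self_of_invariant hsa hidem horth hsum hpos
    hscalar honto' (hφ θ) (hinv θ)
  have hphase (θ θ' : Θ) (h : κ θ = κ θ') : ∃ c : ℂ, ‖c‖ = 1 ∧ c • φ θ = φ θ' := by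
    refine exists_norm_one_smul_eq_of_inner_apply_eq (hφ θ) (hφ θ') fun x => ?_
    obtain ⟨c, hc⟩ := hscalar x (κ θ)
    have h1 := hc (φ θ)
    have h2 := hc (φ θ')
    rw [hκ] at h1
    rw [h, hκ] at h2
    rw [← hinv θ, ← hinv θ', h1, h2, inner_smul_right, inner_smul_right, inner_self_eq_norm_sq_to_K,
      inner_self_eq_norm_sq_to_K, hφ, hφ]
  have hv (k : ℕ) : ∃ v : H, e k v = v ∧ ‖v‖ ≤ 1 ∧
      ∀ θ, κ θ = k → ∃ c : ℂ, ‖c‖ = 1 ∧ c • φ θ = v := by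
    by_cases h : ∃ θ, κ θ = k
    · obtain ⟨θ, rfl⟩ := h
      exact ⟨φ θ, hκ θ, (hφ θ).le, fun θ' h' => hphase θ' θ h'⟩
    · exact ⟨0, by simp, by simp, fun θ hθ => (h ⟨θ, hθ⟩).elim⟩
  choose v hev hnorm hv using hv
  obtain ⟨χ, hχ⟩ := exists_apply_eq_smul horth hev hnorm
  choose c hc hcv using fun θ => hv (κ θ) θ rfl
  refine ⟨χ, c, fun θ => Pi.single (κ θ) (2 ^ κ θ), hc, fun θ => ?_⟩
  rw [hcv, ← hχ (κ θ)]
  convert hasSum_single (κ θ) fun j hj => ?_ using 1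
  · simp only [Pi.single_eq_same, Complex.coe_smul]
  · simp [hj]
end
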